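/- arXiv:math/0409376 — 2 statements merged into one kernel-verified Lean document; each statement's English description precedes it below -/
import Mathlib

section
/- Let g ≥ 1. Then there exists a nonzero scalar λ ∈ ℂ such that e₁^{g(g+1)/2} − λ · (e₁ e₂ ⋯ e_g) belongs to the ideal I_g; that is, in the quotient ring the power σ₁^{g(g+1)/2} of the Kähler class equals a nonzero multiple of σ₁σ₂⋯σ_g. -/
open MvPolynomial

/-- `esq g k` is `e_k(x₁²,…,x_g²)`, the `k`-th elementary symmetric polynomial
evaluated at the squares of the variables. -/
noncomputable def esq (g k : ℕ) : MvPolynomial (Fin g) ℂ :=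
  aeval (fun i : Fin g => (X i : MvPolynomial (Fin g) ℂ) ^ 2) (esymm (Fin g) ℂ k)

/-- The ideal `I_g` generated by `e_k(x₁²,…,x_g²)` for `1 ≤ k ≤ g`. -/
noncomputable def Ig (g : ℕ) : Ideal (MvPolynomial (Fin g) ℂ) :=
  Ideal.span {p | ∃ k : ℕ, 1 ≤ k ∧ k ≤ g ∧ p = esq g k}

section Nilpotency

/-- The generating function of the complete homogeneous polynomials in `y 0, …, y (k - 1)`. -/
noncomputable def hsymmSeries {A : Type*} [CommRing A] (y : ℕ → A) (k : ℕ) : PowerSeries A :=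
  ∏ i ∈ Finset.range k, PowerSeries.mk fun n => y i ^ n

variable {A : Type*} [CommRing A] (y : ℕ → A)

theorem mk_pow_mul_one_sub (a : A) :
    (PowerSeries.mk fun n => a ^ n) * (1 - PowerSeries.C a * PowerSeries.X) = 1 := by
  ext n
  rw [mul_sub, mul_one, map_sub, mul_left_comm, PowerSeries.coeff_C_mul]
  cases n with
  | zero => simp
  | succ n => simp [PowerSeries.coeff_succ_mul_X, pow_succ', PowerSeries.coeff_one]

theorem hsymmSeries_succ_mul (k : ℕ) :
    hsymmSeries y (k + 1) * (1 - PowerSeries.C (y k) * PowerSeries.X) = hsymmSeries y k := by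
  rw [hsymmSeries, Finset.prod_range_succ, mul_assoc, mk_pow_mul_one_sub, mul_one, hsymmSeries]

theorem hsymmSeries_mul_prod (k : ℕ) :
    hsymmSeries y k * ∏ i ∈ Finset.range k, (1 - PowerSeries.C (y i) * PowerSeries.X) = 1 := by
  rw [hsymmSeries, ← Finset.prod_mul_distrib]
  exact Finset.prod_eq_one fun i _ => mk_pow_mul_one_sub (y i)

theorem coeff_zero_hsymmSeries (k : ℕ) : PowerSeries.coeff 0 (hsymmSeries y k) = 1 := by
  simp [hsymmSeries, map_prod, PowerSeries.constantCoeff_mk]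

theorem coeff_hsymmSeries_mem (K : Type*) [CommRing K] [Algebra K A] (k n : ℕ) :
    PowerSeries.coeff n (hsymmSeries y k) ∈ Submodule.span K (y '' Set.Iio k) ^ n := by
  induction k generalizing n with
  | zero =>
    rcases n with _ | n
    · simp [hsymmSeries, Submodule.one_le.mp le_rfl]
    · simp [hsymmSeries, PowerSeries.coeff_one]
  | succ k ih =>
    rw [hsymmSeries, Finset.prod_range_succ, PowerSeries.coeff_mul]
    refine Submodule.sum_mem _ fun p hp => ?_
    rw [← Finset.HasAntidiagonal.mem_antidiagonal.mp hp, pow_add, PowerSeries.coeff_mk]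
    refine Submodule.mul_mem_mul ?_ ?_
    · refine pow_le_pow_left' (?_ : Submodule.span K (y '' Set.Iio k) ≤ _) p.1 (ih p.1)
      exact Submodule.span_mono (Set.image_mono (Set.Iio_subset_Iio k.le_succ))
    · exact Submodule.pow_mem_pow _ (Submodule.subset_span (Set.mem_image_of_mem y (by simp))) _

variable {y} {g : ℕ}
  (h : ∏ i ∈ Finset.range g, (1 - PowerSeries.C (y i) * PowerSeries.X) = 1)
include h

theorem coeff_hsymmSeries_eq_zero {m k n : ℕ} (hk : k + m = g) (hn : m < n) :
    PowerSeries.coeff n (hsymmSeries y k) = 0 := by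
  induction m generalizing k n with
  | zero =>
    have h1 := hsymmSeries_mul_prod y g
    rw [h, mul_one] at h1
    rw [show k = g from hk, h1, PowerSeries.coeff_one, if_neg hn.ne']
  | succ m ih =>
    obtain ⟨n, rfl⟩ : ∃ n', n = n' + 1 := ⟨n - 1, by omega⟩
    rw [← hsymmSeries_succ_mul, mul_sub, mul_one, map_sub, mul_left_comm, PowerSeries.coeff_C_mul,
      PowerSeries.coeff_succ_mul_X, ih (by omega) (by omega), ih (by omega) (by omega)]
    simp

theorem mul_pow_eq_zero_of_mem_span_pow (K : Type*) [CommRing K] [Algebra K A] {k D : ℕ}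
    (hk : k < g) (ih : ∀ d, D < d → Submodule.span K (y '' Set.Iio k) ^ d = ⊥)
    {a b : ℕ} (hab : D + (g - 1 - k) < a + b) {x : A}
    (hx : x ∈ Submodule.span K (y '' Set.Iio k) ^ a) : x * y k ^ b = 0 := by
  induction b using Nat.strong_induction_on generalizing a x with
  | _ b IH =>
    rcases lt_or_ge b (g - k) with hb | hb
    · rw [ih a (by omega), Submodule.mem_bot] at hx
      rw [hx, zero_mul]
    · have h1 : PowerSeries.coeff (g - k) (hsymmSeries y (k + 1)) = 0 :=
        coeff_hsymmSeries_eq_zero h (m := g - (k + 1)) (by omega) (by omega)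
      rw [hsymmSeries, Finset.prod_range_succ, PowerSeries.coeff_mul,
        Finset.Nat.sum_antidiagonal_eq_sum_range_succ_mk, Finset.sum_range_succ'] at h1
      change _ + PowerSeries.coeff 0 (hsymmSeries y k) * _ = (0 : A) at h1
      rw [coeff_zero_hsymmSeries, one_mul, PowerSeries.coeff_mk, Nat.sub_zero] at h1
      have h2 : x * y k ^ b = x * y k ^ (b - (g - k)) * y k ^ (g - k) := by
        rw [mul_assoc, ← pow_add, Nat.sub_add_cancel hb]
      rw [h2, eq_neg_of_add_eq_zero_right h1, mul_neg, Finset.mul_sum, neg_eq_zero]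
      refine Finset.sum_eq_zero fun i hi => ?_
      rw [Finset.mem_range] at hi
      have h3 := IH (b - (i + 1)) (by omega) (a := a + (i + 1)) (by omega)
        (x := x * PowerSeries.coeff (i + 1) (hsymmSeries y k))
        (by rw [pow_add]; exact Submodule.mul_mem_mul hx (coeff_hsymmSeries_mem y K k (i + 1)))
      rw [← h3, show b - (i + 1) = (b - (g - k)) + (g - k - (i + 1)) by omega, pow_add,
        PowerSeries.coeff_mk]
      simp only [hsymmSeries]
      ring

theorem span_pow_eq_bot (K : Type*) [CommRing K] [Algebra K A] {k : ℕ} (hk : k ≤ g) {d : ℕ}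
    (hd : ∑ i ∈ Finset.range k, (g - 1 - i) < d) :
    Submodule.span K (y '' Set.Iio k) ^ d = ⊥ := by
  induction k generalizing d with
  | zero =>
    have : Set.Iio 0 = (∅ : Set ℕ) := by ext; simp
    rw [this, Set.image_empty, Submodule.span_empty, Submodule.bot_pow (by omega)]
  | succ k ih =>
    rw [Finset.sum_range_succ] at hd
    have h1 : Set.Iio (k + 1) = Set.Iio k ∪ {k} := by
      ext; simp only [Set.mem_Iio, Set.mem_union, Set.mem_singleton_iff]; omega
    rw [h1, Set.image_union, Submodule.span_union, ← Submodule.add_eq_sup, add_pow,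
      ← Submodule.zero_eq_bot]
    refine Finset.sum_eq_zero fun m hm => ?_
    rw [Finset.mem_range] at hm
    suffices Submodule.span K (y '' Set.Iio k) ^ m * Submodule.span K (y '' {k}) ^ (d - m) = 0 by
      rw [this, zero_mul]
    rw [Submodule.zero_eq_bot, eq_bot_iff, Submodule.mul_le, Set.image_singleton,
      Submodule.span_pow {y k}, Set.singleton_pow]
    intro x hx z hz
    obtain ⟨c, rfl⟩ := Submodule.mem_span_singleton.mp hz
    rw [mul_smul_comm, mul_pow_eq_zero_of_mem_span_pow h K (by omega)
      (fun d hd => ih (by omega) hd) (a := m) (b := d - m) (by omega) hx, smul_zero]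
    exact Submodule.zero_mem _

theorem prod_pow_eq_zero_of_lt_sum {β : ℕ → ℕ}
    (hβ : ∑ i ∈ Finset.range g, i < ∑ i ∈ Finset.range g, β i) :
    ∏ i ∈ Finset.range g, y i ^ β i = 0 := by
  have h1 : ∀ s ⊆ Finset.range g, ∏ i ∈ s, y i ^ β i ∈
      Submodule.span ℤ (y '' Set.Iio g) ^ ∑ i ∈ s, β i := by
    intro s
    induction s using Finset.induction_on with
    | empty => simp [Submodule.one_le.mp le_rfl]
    | insert j s hj ih =>
      intro hs
      obtain ⟨hjg, hsg⟩ := Finset.insert_subset_iff.mp hs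
      rw [Finset.prod_insert hj, Finset.sum_insert hj, pow_add]
      exact Submodule.mul_mem_mul (Submodule.pow_mem_pow _
        (Submodule.subset_span (Set.mem_image_of_mem y (Set.mem_Iio.mpr (Finset.mem_range.mp hjg)))) _) (ih hsg)
  specialize h1 _ subset_rfl
  rwa [span_pow_eq_bot h ℤ le_rfl (by rwa [Finset.sum_range_reflect (fun i => i)]),
    Submodule.mem_bot] at h1

end Nilpotency

theorem prod_one_sub_mul {ι R : Type*} [Fintype ι] [CommRing R] (a : ι → R) (t : R) :
    ∏ i, (1 - a i * t) = ∑ k ∈ Finset.range (Fintype.card ι + 1),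
      (∑ s ∈ Finset.powersetCard k Finset.univ, ∏ i ∈ s, a i) * (-t) ^ k := by
  simp only [sub_eq_add_neg, ← mul_neg]
  rw [Finset.prod_one_add, Finset.sum_powerset, Finset.card_univ]
  refine Finset.sum_congr rfl fun k _ => ?_
  rw [Finset.sum_mul]
  refine Finset.sum_congr rfl fun s hs => ?_
  rw [Finset.prod_mul_distrib, Finset.prod_const, (Finset.mem_powersetCard.mp hs).2]

theorem prod_one_sub_mk_X_sq (g : ℕ) :
    ∏ i : Fin g, (1 - PowerSeries.C (Ideal.Quotient.mk (Ig g) (X i ^ 2)) * PowerSeries.X) = 1 := by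
  rw [prod_one_sub_mul, Finset.sum_range_succ', Finset.powersetCard_zero, Finset.sum_singleton,
    Finset.prod_empty, pow_zero, mul_one, add_eq_right]
  refine Finset.sum_eq_zero fun k hk => ?_
  rw [Finset.mem_range, Fintype.card_fin] at hk
  have h1 : Ideal.Quotient.mk (Ig g) (esq g (k + 1)) = 0 :=
    Ideal.Quotient.eq_zero_iff_mem.mpr (Ideal.subset_span ⟨k + 1, by omega, hk, rfl⟩)
  rw [esq, aeval_esymm_eq_multiset_esymm, Finset.esymm_map_val,
    map_sum (Ideal.Quotient.mk (Ig g))] at h1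
  simp only [← map_prod, ← map_sum]
  rw [map_sum (Ideal.Quotient.mk (Ig g)), h1, map_zero, zero_mul]

theorem monomial_mem_Ig {g : ℕ} {α : Fin g →₀ ℕ} (c : ℂ)
    (hα : ∑ i ∈ Finset.range g, i < ∑ i, α i / 2) : monomial α c ∈ Ig g := by
  have h0 := prod_one_sub_mk_X_sq g
  let y : ℕ → MvPolynomial (Fin g) ℂ ⧸ Ig g := fun i =>
    if hi : i < g then Ideal.Quotient.mk (Ig g) (X ⟨i, hi⟩ ^ 2) else 0
  let β : ℕ → ℕ := fun i => if hi : i < g then α ⟨i, hi⟩ / 2 else 0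
  have h1 : ∏ i ∈ Finset.range g, y i ^ β i = 0 := by
    refine prod_pow_eq_zero_of_lt_sum ?_ ?_
    · rw [Finset.prod_range]
      simpa [y] using h0
    · rw [Finset.sum_range β]
      simpa [β] using hα
  rw [Finset.prod_range] at h1
  simp only [y, β, Fin.is_lt, dite_true, Fin.eta] at h1
  rw [← Ideal.Quotient.eq_zero_iff_mem, monomial_eq, map_mul,
    Finsupp.prod_fintype _ _ (fun _ => pow_zero _), map_prod]
  have h2 : ∀ i, Ideal.Quotient.mk (Ig g) (X i ^ α i) =
      Ideal.Quotient.mk (Ig g) (X i ^ 2) ^ (α i / 2) *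
        Ideal.Quotient.mk (Ig g) (X i) ^ (α i % 2) := fun i => by
    rw [← map_pow, ← map_pow, ← map_mul, ← pow_mul, ← pow_add, Nat.div_add_mod]
  simp_rw [h2]
  rw [Finset.prod_mul_distrib, h1, zero_mul, mul_zero]

section Alternating

/-- A polynomial on which permutations of the variables act through their sign. -/
def IsAlternatingPoly {g : ℕ} (F : MvPolynomial (Fin g) ℂ) : Prop :=
  ∀ σ : Equiv.Perm (Fin g), rename σ F = C ((Equiv.Perm.sign σ : ℤ) : ℂ) * F

variable {g : ℕ} {F : MvPolynomial (Fin g) ℂ}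

theorem MvPolynomial.IsSymmetric.mul_isAlternatingPoly {p : MvPolynomial (Fin g) ℂ}
    (hp : p.IsSymmetric) (hF : IsAlternatingPoly F) : IsAlternatingPoly (p * F) := fun σ => by
  rw [map_mul, hp σ, hF σ, mul_left_comm]

theorem IsAlternatingPoly.coeff_mapDomain (hF : IsAlternatingPoly F) (σ : Equiv.Perm (Fin g))
    (α : Fin g →₀ ℕ) :
    coeff (α.mapDomain σ) F = ((Equiv.Perm.sign σ : ℤ) : ℂ) * coeff α F := by
  have h1 := coeff_rename_mapDomain σ σ.injective F α
  rw [hF σ, coeff_C_mul] at h1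
  rw [← h1, ← mul_assoc, ← Int.cast_mul, ← Units.val_mul, Int.units_mul_self]
  simp

theorem IsAlternatingPoly.coeff_eq_zero (hF : IsAlternatingPoly F) {α : Fin g →₀ ℕ} {i j : Fin g}
    (hij : i ≠ j) (hα : α i = α j) : coeff α F = 0 := by
  have h1 := hF.coeff_mapDomain (Equiv.swap i j) α
  have h2 : α.mapDomain (Equiv.swap i j) = α := by
    ext k
    rw [Finsupp.mapDomain_equiv_apply, Equiv.symm_swap]
    by_cases hi : k = i
    · rw [hi, Equiv.swap_apply_left, hα]
    by_cases hj : k = j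
    · rw [hj, Equiv.swap_apply_right, hα]
    rw [Equiv.swap_apply_of_ne_of_ne hi hj]
  rw [h2, Equiv.Perm.sign_swap hij] at h1
  push_cast at h1
  linear_combination h1 / 2

theorem X_sub_X_dvd_sub_rename (i j : Fin g) (p : MvPolynomial (Fin g) ℂ) :
    (X j - X i : MvPolynomial (Fin g) ℂ) ∣ p - rename (Function.update id j i) p := by
  rw [← Ideal.mem_span_singleton, ← Ideal.Quotient.eq]
  change (Ideal.Quotient.mkₐ ℂ _) p = ((Ideal.Quotient.mkₐ ℂ _).comp (rename _)) p
  congr 1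
  refine algHom_ext fun k => ?_
  rw [AlgHom.comp_apply, rename_X]
  rcases eq_or_ne k j with rfl | hk
  · rw [Function.update_self]
    exact Ideal.Quotient.eq.mpr (Ideal.mem_span_singleton_self _)
  · rw [Function.update_of_ne hk, id]

theorem IsAlternatingPoly.X_sub_X_dvd (hF : IsAlternatingPoly F) {i j : Fin g} (hij : i ≠ j) :
    (X j - X i : MvPolynomial (Fin g) ℂ) ∣ F := by
  have h1 := X_sub_X_dvd_sub_rename i j F
  have h2 := congrArg (rename (R := ℂ) (Function.update id j i)) (hF (Equiv.swap i j))
  have h3 : Function.update id j i ∘ Equiv.swap i j = Function.update id j i := by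
    funext k
    rw [Function.comp_apply]
    by_cases hi : k = i
    · rw [hi, Equiv.swap_apply_left, Function.update_self, Function.update_of_ne hij, id]
    by_cases hj : k = j
    · rw [hj, Equiv.swap_apply_right, Function.update_self, Function.update_of_ne hij, id]
    rw [Equiv.swap_apply_of_ne_of_ne hi hj]
  rw [rename_rename, h3, Equiv.Perm.sign_swap hij, map_mul, rename_C] at h2
  have h4 : rename (Function.update id j i) F = 0 := by
    refine (mul_eq_zero.mp (?_ : C (2 : ℂ) * rename (Function.update id j i) F = 0)).resolve_left ?_
    · simp only [map_ofNat]
      push_cast at h2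
      simp only [map_neg, map_one] at h2
      linear_combination h2
    · exact fun h => two_ne_zero (C_eq_zero.mp h)
  rwa [h4, sub_zero] at h1

theorem irreducible_X_sub_X {i j : Fin g} (hij : i ≠ j) :
    Irreducible (X j - X i : MvPolynomial (Fin g) ℂ) := by
  have h := irreducible_mul_X_add (R := ℂ) (1 : MvPolynomial (Fin g) ℂ) (-X i) j one_ne_zero
    (by simp) (by rw [vars_neg, vars_X]; simpa using hij.symm) isRelPrime_one_left
  rwa [one_mul, ← sub_eq_add_neg] at h

theorem not_X_sub_X_dvd {i j k l : Fin g} (hij : i < j) (hkl : k < l) (hne : (i, j) ≠ (k, l)) :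
    ¬ (X j - X i : MvPolynomial (Fin g) ℂ) ∣ X l - X k := by
  intro h
  have h1 := map_dvd (rename (R := ℂ) (Function.update id j i)) h
  rw [map_sub, map_sub, rename_X, rename_X, rename_X, rename_X, Function.update_self,
    Function.update_of_ne hij.ne, id, sub_self, zero_dvd_iff, sub_eq_zero] at h1
  have h2 := X_injective h1
  rw [Function.update_apply, Function.update_apply] at h2
  simp only [id] at h2
  split_ifs at h2 <;> grind

/-- The Vandermonde determinant in the variables. -/
noncomputable def vandermondePoly (g : ℕ) : MvPolynomial (Fin g) ℂ :=
  (Matrix.vandermonde (X : Fin g → MvPolynomial (Fin g) ℂ)).det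

theorem vandermondePoly_ne_zero (g : ℕ) : vandermondePoly g ≠ 0 :=
  Matrix.det_vandermonde_ne_zero_iff.mpr X_injective

theorem isAlternatingPoly_vandermondePoly (g : ℕ) : IsAlternatingPoly (vandermondePoly g) := by
  intro σ
  rw [vandermondePoly, AlgHom.map_det]
  have h : (rename (R := ℂ) σ).mapMatrix (Matrix.vandermonde (X : Fin g → MvPolynomial (Fin g) ℂ)) =
      (Matrix.vandermonde (X : Fin g → MvPolynomial (Fin g) ℂ)).submatrix σ id := by
    ext i j : 2
    simp [Matrix.vandermonde_apply]
  rw [h, Matrix.det_permute]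
  simp

theorem IsAlternatingPoly.vandermondePoly_dvd (hF : IsAlternatingPoly F) :
    vandermondePoly g ∣ F := by
  rw [vandermondePoly, Matrix.det_vandermonde, Finset.prod_sigma']
  refine Finset.prod_dvd_of_isRelPrime ?_ ?_
  · rintro ⟨i, j⟩ hij ⟨k, l⟩ hkl hne
    simp only [Finset.coe_sigma, Set.mem_sigma_iff, Finset.coe_univ, Set.mem_univ, true_and,
      Finset.coe_Ioi, Set.mem_Ioi] at hij hkl
    refine (irreducible_X_sub_X hij.ne).isRelPrime_iff_not_dvd.mpr (not_X_sub_X_dvd hij hkl ?_)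
    rintro h
    simp_all
  · rintro ⟨i, j⟩ hij
    simp only [Finset.mem_sigma, Finset.mem_univ, true_and, Finset.mem_Ioi] at hij
    exact hF.X_sub_X_dvd hij.ne

theorem vandermondePoly_eq_sum (g : ℕ) : vandermondePoly g =
    ∑ σ : Equiv.Perm (Fin g), monomial (Finsupp.equivFunOnFinite.symm fun i => (σ i : ℕ))
      ((Equiv.Perm.sign σ : ℤ) : ℂ) := by
  rw [vandermondePoly, ← Matrix.det_transpose, Matrix.det_apply']
  refine Finset.sum_congr rfl fun σ _ => ?_
  rw [monomial_eq, Finsupp.prod_fintype _ _ (fun _ => pow_zero _)]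
  simp [Matrix.vandermonde_apply]

theorem isHomogeneous_vandermondePoly (g : ℕ) :
    (vandermondePoly g).IsHomogeneous (∑ i ∈ Finset.range g, i) := by
  rw [vandermondePoly_eq_sum]
  refine IsHomogeneous.sum _ _ _ fun σ _ => isHomogeneous_monomial _ ?_
  rw [Finsupp.degree_eq_sum, Finset.sum_range]
  exact Equiv.sum_comp σ (fun i : Fin g => (i : ℕ))

/-- The signed sum of the permuted copies of a polynomial. -/
noncomputable def alternate (p : MvPolynomial (Fin g) ℂ) : MvPolynomial (Fin g) ℂ :=
  ∑ σ : Equiv.Perm (Fin g), C ((Equiv.Perm.sign σ : ℤ) : ℂ) * rename σ p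

theorem isAlternatingPoly_alternate (p : MvPolynomial (Fin g) ℂ) :
    IsAlternatingPoly (alternate p) := by
  intro τ
  rw [alternate, map_sum, Finset.mul_sum]
  refine Fintype.sum_equiv (Equiv.mulLeft τ) _ _ fun σ => ?_
  rw [map_mul, rename_C, rename_rename, Equiv.coe_mulLeft, ← mul_assoc, ← C_mul, ← Int.cast_mul,
    ← Units.val_mul, Equiv.Perm.sign_mul, ← mul_assoc, Int.units_mul_self, one_mul,
    Equiv.Perm.coe_mul]

theorem alternate_mul_of_isSymmetric (p : MvPolynomial (Fin g) ℂ) {q : MvPolynomial (Fin g) ℂ}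
    (hq : q.IsSymmetric) : alternate (p * q) = alternate p * q := by
  simp only [alternate, Finset.sum_mul, map_mul, hq _, mul_assoc]

theorem IsAlternatingPoly.alternate_eq (hF : IsAlternatingPoly F) :
    alternate F = C (g.factorial : ℂ) * F := by
  have h : ∀ σ : Equiv.Perm (Fin g),
      C ((Equiv.Perm.sign σ : ℤ) : ℂ) * (C ((Equiv.Perm.sign σ : ℤ) : ℂ) * F) = F := fun σ => by
    rw [← mul_assoc, ← C_mul, ← Int.cast_mul, ← Units.val_mul, Int.units_mul_self]
    simp
  simp only [alternate, hF _, h, Finset.sum_const, Finset.card_univ, Fintype.card_perm,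
    Fintype.card_fin, nsmul_eq_mul]
  simp

theorem isSymmetric_esq (g k : ℕ) : (esq g k).IsSymmetric := by
  intro σ
  have h : (rename (R := ℂ) σ).comp (aeval fun i : Fin g => (X i : MvPolynomial (Fin g) ℂ) ^ 2) =
      (aeval fun i : Fin g => (X i : MvPolynomial (Fin g) ℂ) ^ 2).comp (rename σ) := by
    refine algHom_ext fun i => ?_
    simp
  rw [esq, ← AlgHom.comp_apply, h, AlgHom.comp_apply, esymm_isSymmetric (Fin g) ℂ k σ]

theorem alternate_mem {p : MvPolynomial (Fin g) ℂ} (hp : p ∈ Ig g) :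
    ∃ q ∈ Ig g, alternate p = vandermondePoly g * q := by
  suffices ∀ a : MvPolynomial (Fin g) ℂ, ∃ q ∈ Ig g, alternate (a * p) = vandermondePoly g * q by
    simpa using this 1
  refine Submodule.span_induction ?_ ?_ ?_ ?_ hp
  · rintro _ ⟨k, hk, hkg, rfl⟩ a
    obtain ⟨b, hb⟩ := (isAlternatingPoly_alternate a).vandermondePoly_dvd
    refine ⟨b * esq g k, Ideal.mul_mem_left _ _ (Ideal.subset_span ⟨k, hk, hkg, rfl⟩), ?_⟩
    rw [alternate_mul_of_isSymmetric _ (isSymmetric_esq g k), hb, mul_assoc]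
  · exact fun a => ⟨0, Ideal.zero_mem _, by simp [alternate]⟩
  · intro x y _ _ hx hy a
    obtain ⟨q, hq, hxq⟩ := hx a
    obtain ⟨r, hr, hyr⟩ := hy a
    refine ⟨q + r, Ideal.add_mem _ hq hr, ?_⟩
    rw [mul_add, mul_add, ← hxq, ← hyr]
    simp only [alternate, map_add, mul_add, Finset.sum_add_distrib]
  · intro r x _ hx a
    rw [smul_eq_mul, ← mul_assoc]
    exact hx (a * r)

theorem mem_Ig_of_mul_vandermondePoly_mem {p : MvPolynomial (Fin g) ℂ} (hp : p.IsSymmetric)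
    (h : p * vandermondePoly g ∈ Ig g) : p ∈ Ig g := by
  obtain ⟨q, hq, hpq⟩ := alternate_mem h
  rw [(hp.mul_isAlternatingPoly (isAlternatingPoly_vandermondePoly g)).alternate_eq, ← mul_assoc,
    mul_comm] at hpq
  have h1 := mul_left_cancel₀ (vandermondePoly_ne_zero g) hpq
  have h2 : p = C ((g.factorial : ℂ)⁻¹) * q := by
    rw [← h1, ← mul_assoc, ← C_mul,
      inv_mul_cancel₀ (Nat.cast_ne_zero.mpr g.factorial_ne_zero), C_1, one_mul]
  rw [h2]
  exact Ideal.mul_mem_left _ _ hq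

end Alternating

section TopDegree

variable {g : ℕ} {F : MvPolynomial (Fin g) ℂ}

/-- The exponent `(1, 3, …, 2 g - 1)`. -/
noncomputable def oddExponent (g : ℕ) : Fin g →₀ ℕ :=
  Finsupp.equivFunOnFinite.symm fun i => 2 * i + 1

theorem sum_lt_sum_div_two_of_even {α : Fin g →₀ ℕ} (hα : ∑ i, α i = g ^ 2) {j : Fin g}
    (hj : Even (α j)) : ∑ i ∈ Finset.range g, i < ∑ i, α i / 2 := by
  have h1 : ∑ i, α i % 2 < ∑ _i : Fin g, 1 :=
    Finset.sum_lt_sum (fun i _ => by omega)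
      ⟨j, Finset.mem_univ j, by rw [Nat.even_iff.mp hj]; exact one_pos⟩
  have h2 : ∑ i, α i = 2 * ∑ i, α i / 2 + ∑ i, α i % 2 := by
    rw [Finset.mul_sum, ← Finset.sum_add_distrib]
    exact Finset.sum_congr rfl fun i _ => (Nat.div_add_mod _ _).symm
  have h3 := Finset.sum_range_id_mul_two g
  have h4 : g * (g - 1) + g = g ^ 2 := by
    cases g with
    | zero => rfl
    | succ n => rw [Nat.add_sub_cancel]; ring
  simp only [Finset.sum_const, Finset.card_univ, Fintype.card_fin, smul_eq_mul, mul_one] at h1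
  omega

theorem sum_two_mul_add_one (g : ℕ) : ∑ i : Fin g, (2 * (i : ℕ) + 1) = g ^ 2 := by
  rw [← Finset.sum_range fun i => 2 * i + 1]
  induction g with
  | zero => rfl
  | succ n ih => rw [Finset.sum_range_succ, ih]; ring

theorem two_mul_add_one_le_of_strictMono {f : Fin g → ℕ} (hf : StrictMono f)
    (hodd : ∀ i, Odd (f i)) (i : Fin g) : 2 * (i : ℕ) + 1 ≤ f i := by
  obtain ⟨i, hi⟩ := i
  induction i with
  | zero => exact (hodd _).pos
  | succ i ih =>
    have h1 := ih (Nat.lt_of_succ_lt hi)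
    have h2 : f ⟨i, Nat.lt_of_succ_lt hi⟩ < f ⟨i + 1, hi⟩ := hf (Fin.mk_lt_mk.mpr i.lt_succ_self)
    obtain ⟨a, ha⟩ := hodd ⟨i, Nat.lt_of_succ_lt hi⟩
    obtain ⟨b, hb⟩ := hodd ⟨i + 1, hi⟩
    simp only at h1 ⊢
    omega

theorem exists_mapDomain_eq_oddExponent {α : Fin g →₀ ℕ} (hα : ∑ i, α i = g ^ 2)
    (hodd : ∀ i, Odd (α i)) (hinj : Function.Injective α) :
    ∃ σ : Equiv.Perm (Fin g), α.mapDomain σ = oddExponent g := by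
  have h1 : StrictMono (α ∘ Tuple.sort α) :=
    (Tuple.monotone_sort α).strictMono_of_injective (hinj.comp (Tuple.sort α).injective)
  have h2 := two_mul_add_one_le_of_strictMono h1 fun i => hodd _
  have h3 := (Finset.sum_eq_sum_iff_of_le fun i _ => h2 i).mp (by
    rw [sum_two_mul_add_one, ← hα]
    exact (Equiv.sum_comp (Tuple.sort α) α).symm)
  refine ⟨(Tuple.sort α).symm, ?_⟩
  ext i
  rw [Finsupp.mapDomain_equiv_apply, Equiv.symm_symm]
  exact (h3 i (Finset.mem_univ i)).symm

theorem IsAlternatingPoly.mem_Ig (hF : IsAlternatingPoly F) (hdeg : F.IsHomogeneous (g ^ 2))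
    (h : coeff (oddExponent g) F = 0) : F ∈ Ig g := by
  rw [F.as_sum]
  refine Ideal.sum_mem _ fun α hα => monomial_mem_Ig _ ?_
  rw [mem_support_iff] at hα
  have hsum : ∑ i, α i = g ^ 2 := by
    rw [← Finsupp.degree_eq_sum, Finsupp.degree_eq_weight_one]
    exact hdeg hα
  by_cases hodd : ∀ i, Odd (α i)
  · have hinj : Function.Injective α := fun i j hij => by
      by_contra hne
      exact hα (hF.coeff_eq_zero hne hij)
    obtain ⟨σ, hσ⟩ := exists_mapDomain_eq_oddExponent hsum hodd hinj
    rw [← hσ, hF.coeff_mapDomain, mul_eq_zero] at h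
    exact absurd (h.resolve_left (by simp)) hα
  · push Not at hodd
    obtain ⟨j, hj⟩ := hodd
    exact sum_lt_sum_div_two_of_even hsum (Nat.not_odd_iff_even.mp hj)

end TopDegree

section Positivity

open scoped ComplexOrder

variable {g : ℕ}

/-- An alternating polynomial whose coefficients at strictly increasing exponents are
nonnegative. -/
structure IsPositiveAlternating (F : MvPolynomial (Fin g) ℂ) : Prop where
  isAlternatingPoly : IsAlternatingPoly F
  coeff_nonneg : ∀ α : Fin g →₀ ℕ, StrictMono α → 0 ≤ coeff α F

/-- The indicator exponent of a set of variables. -/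
noncomputable def indicatorExponent (t : Finset (Fin g)) : Fin g →₀ ℕ :=
  ∑ i ∈ t, Finsupp.single i 1

theorem indicatorExponent_apply (t : Finset (Fin g)) (i : Fin g) :
    indicatorExponent t i = if i ∈ t then 1 else 0 := by
  rw [indicatorExponent, Finsupp.finsetSum_apply]
  simp [Finsupp.single_apply]

theorem coeff_esymm_mul (j : ℕ) (F : MvPolynomial (Fin g) ℂ) (α : Fin g →₀ ℕ) :
    coeff α (esymm (Fin g) ℂ j * F) = ∑ t ∈ Finset.powersetCard j Finset.univ,
      if indicatorExponent t ≤ α then coeff (α - indicatorExponent t) F else 0 := by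
  rw [esymm_eq_sum_monomial, Finset.sum_mul, coeff_sum]
  refine Finset.sum_congr rfl fun t _ => ?_
  rw [coeff_monomial_mul', one_mul]
  rfl

namespace IsPositiveAlternating

variable {F : MvPolynomial (Fin g) ℂ} (hF : IsPositiveAlternating F)
include hF

theorem coeff_sub_nonneg {α : Fin g →₀ ℕ} (hα : StrictMono α) (t : Finset (Fin g)) :
    0 ≤ if indicatorExponent t ≤ α then coeff (α - indicatorExponent t) F else 0 := by
  split_ifs
  · by_cases hinj : Function.Injective (α - indicatorExponent t)
    · refine hF.coeff_nonneg _ (Monotone.strictMono_of_injective ?_ hinj)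
      refine monotone_iff_forall_lt.mpr fun i j hij => ?_
      have := hα hij
      rw [Finsupp.tsub_apply, Finsupp.tsub_apply, indicatorExponent_apply, indicatorExponent_apply]
      split_ifs <;> omega
    · rw [Function.Injective] at hinj
      push Not at hinj
      obtain ⟨i, j, hij, hne⟩ := hinj
      exact (hF.isAlternatingPoly.coeff_eq_zero hne hij).ge
  · exact le_rfl

theorem esymm_mul (j : ℕ) : IsPositiveAlternating (esymm (Fin g) ℂ j * F) where
  isAlternatingPoly := (esymm_isSymmetric (Fin g) ℂ j).mul_isAlternatingPoly hF.isAlternatingPoly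
  coeff_nonneg α hα := by
    rw [coeff_esymm_mul]
    exact Finset.sum_nonneg fun t _ => hF.coeff_sub_nonneg hα t

theorem esymm_one_pow_mul (j : ℕ) : IsPositiveAlternating (esymm (Fin g) ℂ 1 ^ j * F) := by
  induction j with
  | zero => rwa [pow_zero, one_mul]
  | succ j ih =>
    rw [pow_succ', mul_assoc]
    exact ih.esymm_mul 1

theorem coeff_le_coeff_esymm_mul {α : Fin g →₀ ℕ} {t : Finset (Fin g)}
    (hα : StrictMono (α + indicatorExponent t)) :
    coeff α F ≤ coeff (α + indicatorExponent t) (esymm (Fin g) ℂ t.card * F) := by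
  rw [coeff_esymm_mul]
  have h := Finset.single_le_sum (fun s _ => hF.coeff_sub_nonneg hα s)
    (Finset.mem_powersetCard.mpr ⟨t.subset_univ, rfl⟩)
  rwa [if_pos le_add_self, add_tsub_cancel_right] at h

end IsPositiveAlternating

/-- The last `j` variables. -/
def lastVars (g j : ℕ) : Finset (Fin g) :=
  Finset.univ.filter fun i => g ≤ i + j

theorem mem_lastVars {j : ℕ} {i : Fin g} : i ∈ lastVars g j ↔ g ≤ i + j := by
  simp [lastVars]

theorem lastVars_zero : lastVars g 0 = ∅ := by
  ext i
  simp [mem_lastVars]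

theorem lastVars_succ {j : ℕ} (hj : j < g) :
    lastVars g (j + 1) = insert ⟨g - 1 - j, by omega⟩ (lastVars g j) := by
  ext i
  rw [Finset.mem_insert, mem_lastVars, mem_lastVars, Fin.ext_iff]
  simp only
  omega

theorem notMem_lastVars {j : ℕ} (hj : j < g) : ⟨g - 1 - j, by omega⟩ ∉ lastVars g j := by
  rw [mem_lastVars]
  simp only
  omega

theorem card_lastVars {j : ℕ} (hj : j ≤ g) : (lastVars g j).card = j := by
  induction j with
  | zero => rw [lastVars_zero, Finset.card_empty]
  | succ j ih =>
    rw [lastVars_succ hj, Finset.card_insert_of_notMem (notMem_lastVars hj), ih (by omega)]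

theorem strictMono_add_indicatorExponent_lastVars {α : Fin g →₀ ℕ} (hα : StrictMono α) (j : ℕ) :
    StrictMono (α + indicatorExponent (lastVars g j)) := by
  intro a b hab
  have h1 := hα hab
  have h2 : (a : ℕ) < b := hab
  simp only [Finsupp.add_apply, indicatorExponent_apply, mem_lastVars]
  split_ifs <;> omega

theorem IsPositiveAlternating.coeff_le_coeff_esymm_one_pow_mul {F : MvPolynomial (Fin g) ℂ}
    (hF : IsPositiveAlternating F) {α : Fin g →₀ ℕ} (hα : StrictMono α) {j : ℕ} (hj : j ≤ g) :
    coeff α F ≤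
      coeff (α + indicatorExponent (lastVars g j)) (esymm (Fin g) ℂ 1 ^ j * F) := by
  induction j with
  | zero => simp [lastVars_zero, indicatorExponent]
  | succ j ih =>
    refine (ih (by omega)).trans ?_
    have h1 : α + indicatorExponent (lastVars g (j + 1)) =
        α + indicatorExponent (lastVars g j) +
          indicatorExponent {(⟨g - 1 - j, by omega⟩ : Fin g)} := by
      rw [add_assoc, lastVars_succ hj, indicatorExponent,
        Finset.sum_insert (notMem_lastVars hj), indicatorExponent, indicatorExponent,
        Finset.sum_singleton, add_comm (Finsupp.single _ _)]
    have h2 := strictMono_add_indicatorExponent_lastVars hα (j + 1)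
    rw [h1] at h2 ⊢
    rw [pow_succ', mul_assoc]
    exact (hF.esymm_one_pow_mul j).coeff_le_coeff_esymm_mul h2

/-- The exponent `(0, 1, …, g - 1)`. -/
noncomputable def staircaseExponent (g : ℕ) : Fin g →₀ ℕ :=
  Finsupp.equivFunOnFinite.symm fun i => i

theorem strictMono_staircaseExponent : StrictMono (staircaseExponent g) :=
  fun _ _ h => h

theorem coeff_monomial_sign_nonneg {α : Fin g →₀ ℕ} (hα : StrictMono α)
    (σ : Equiv.Perm (Fin g)) :
    0 ≤ coeff α (monomial (Finsupp.equivFunOnFinite.symm fun i => (σ i : ℕ))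
      ((Equiv.Perm.sign σ : ℤ) : ℂ)) := by
  rw [coeff_monomial]
  split_ifs with h
  · have h1 : StrictMono σ := fun i j hij => by
      have := hα hij
      rwa [← h] at this
    have h2 : σ = 1 := by
      ext1 i
      exact congrFun ((StrictMono.range_inj h1 strictMono_id).mp
        (by rw [σ.surjective.range_eq, Set.range_id])) i
    simp [h2]
  · exact le_rfl

theorem isPositiveAlternating_vandermondePoly (g : ℕ) :
    IsPositiveAlternating (vandermondePoly g) where
  isAlternatingPoly := isAlternatingPoly_vandermondePoly g
  coeff_nonneg α hα := by
    rw [vandermondePoly_eq_sum, coeff_sum]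
    exact Finset.sum_nonneg fun σ _ => coeff_monomial_sign_nonneg hα σ

theorem one_le_coeff_vandermondePoly (g : ℕ) :
    1 ≤ coeff (staircaseExponent g) (vandermondePoly g) := by
  rw [vandermondePoly_eq_sum, coeff_sum]
  have h := Finset.single_le_sum
    (fun σ _ => coeff_monomial_sign_nonneg (strictMono_staircaseExponent (g := g)) σ)
    (Finset.mem_univ 1)
  rw [coeff_monomial, if_pos (by ext i; rfl)] at h
  simpa using h

theorem one_le_coeff_prod_mul_vandermondePoly {p : ℕ → MvPolynomial (Fin g) ℂ}
    (hp : ∀ j F, IsPositiveAlternating F → IsPositiveAlternating (p j * F))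
    (hle : ∀ j ≤ g, ∀ F, IsPositiveAlternating F → ∀ α : Fin g →₀ ℕ, StrictMono α →
      coeff α F ≤ coeff (α + indicatorExponent (lastVars g j)) (p j * F)) :
    1 ≤ coeff (oddExponent g) ((∏ j ∈ Finset.Icc 1 g, p j) * vandermondePoly g) := by
  have key : ∀ n ≤ g, IsPositiveAlternating ((∏ j ∈ Finset.Icc 1 n, p j) * vandermondePoly g) ∧
      StrictMono (staircaseExponent g + ∑ j ∈ Finset.Icc 1 n, indicatorExponent (lastVars g j)) ∧
      1 ≤ coeff (staircaseExponent g + ∑ j ∈ Finset.Icc 1 n, indicatorExponent (lastVars g j))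
        ((∏ j ∈ Finset.Icc 1 n, p j) * vandermondePoly g) := by
    intro n hn
    induction n with
    | zero =>
      simpa using ⟨isPositiveAlternating_vandermondePoly g, strictMono_staircaseExponent,
        one_le_coeff_vandermondePoly g⟩
    | succ n ih =>
      obtain ⟨h1, h2, h3⟩ := ih (by omega)
      rw [Finset.prod_Icc_succ_top (by omega), Finset.sum_Icc_succ_top (by omega), mul_right_comm,
        mul_comm _ (p (n + 1)), ← add_assoc]
      exact ⟨hp _ _ h1, strictMono_add_indicatorExponent_lastVars h2 _,
        h3.trans (hle _ hn _ h1 _ h2)⟩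
  have hodd : oddExponent g =
      staircaseExponent g + ∑ j ∈ Finset.Icc 1 g, indicatorExponent (lastVars g j) := by
    ext i
    rw [Finsupp.add_apply, Finsupp.finsetSum_apply]
    simp only [indicatorExponent_apply, mem_lastVars, Finset.sum_boole]
    have h1 : (Finset.Icc 1 g).filter (fun j => g ≤ i + j) = Finset.Icc (g - i) g := by
      ext j
      have := i.is_lt
      simp only [Finset.mem_filter, Finset.mem_Icc]
      omega
    rw [h1, Nat.card_Icc]
    have := i.is_lt
    simp only [oddExponent, staircaseExponent, Finsupp.equivFunOnFinite_symm_apply_apply,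
      Nat.cast_id]
    omega
  rw [hodd]
  exact (key g le_rfl).2.2

theorem coeff_prod_esymm_mul_vandermondePoly_ne_zero (g : ℕ) :
    coeff (oddExponent g)
      ((∏ j ∈ Finset.Icc 1 g, esymm (Fin g) ℂ j) * vandermondePoly g) ≠ 0 := by
  refine (zero_lt_one.trans_le (one_le_coeff_prod_mul_vandermondePoly
    (fun j F hF => hF.esymm_mul j) fun j hj F hF α hα => ?_)).ne'
  have h := hF.coeff_le_coeff_esymm_mul (strictMono_add_indicatorExponent_lastVars hα j)
  rwa [card_lastVars hj] at h

theorem coeff_esymm_one_pow_mul_vandermondePoly_ne_zero (g : ℕ) :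
    coeff (oddExponent g)
      (esymm (Fin g) ℂ 1 ^ (∑ j ∈ Finset.Icc 1 g, j) * vandermondePoly g) ≠ 0 := by
  rw [← Finset.prod_pow_eq_pow_sum]
  exact (zero_lt_one.trans_le (one_le_coeff_prod_mul_vandermondePoly
    (fun j F hF => hF.esymm_one_pow_mul j)
    fun j hj F hF α hα => hF.coeff_le_coeff_esymm_one_pow_mul hα hj)).ne'

end Positivity

theorem sum_Icc_one_mul_two (g : ℕ) : (∑ j ∈ Finset.Icc 1 g, j) * 2 = g * (g + 1) := by
  induction g with
  | zero => rfl
  | succ n ih => rw [Finset.sum_Icc_succ_top (by omega), add_mul, ih]; ring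

theorem isHomogeneous_esymm (g j : ℕ) : (esymm (Fin g) ℂ j).IsHomogeneous j := by
  refine IsHomogeneous.sum _ _ _ fun t ht => ?_
  have h := IsHomogeneous.prod t (X : Fin g → MvPolynomial (Fin g) ℂ) (fun _ => 1)
    fun i _ => isHomogeneous_X ℂ i
  rwa [Finset.sum_const, smul_eq_mul, mul_one, (Finset.mem_powersetCard.mp ht).2] at h

/-- (proof of Lemma `topsymp`) There is a nonzero scalar `λ` such that
`e₁^{g(g+1)/2} - λ · (e₁ e₂ ⋯ e_g) ∈ I_g`: in the quotient ring the power
`σ₁^{g(g+1)/2}` of the Kähler class is a nonzero multiple of `σ₁σ₂⋯σ_g`. -/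
theorem stmt_2 (g : ℕ) (hg : 1 ≤ g) :
    ∃ lam : ℂ, lam ≠ 0 ∧
      (esymm (Fin g) ℂ 1) ^ (g * (g + 1) / 2) -
        C lam * ∏ j ∈ Finset.Icc 1 g, esymm (Fin g) ℂ j ∈ Ig g := by
  rw [← sum_Icc_one_mul_two, Nat.mul_div_cancel _ two_pos]
  have h1 := coeff_esymm_one_pow_mul_vandermondePoly_ne_zero g
  have h2 := coeff_prod_esymm_mul_vandermondePoly_ne_zero g
  refine ⟨_, div_ne_zero h1 h2, ?_⟩
  have hsymm : ∀ c : ℂ, (esymm (Fin g) ℂ 1 ^ (∑ j ∈ Finset.Icc 1 g, j) -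
      C c * ∏ j ∈ Finset.Icc 1 g, esymm (Fin g) ℂ j).IsSymmetric := fun c σ => by
    simp only [map_sub, map_mul, map_pow, map_prod, rename_C, esymm_isSymmetric (Fin g) ℂ _ σ]
  have hhom : ∀ c : ℂ, (esymm (Fin g) ℂ 1 ^ (∑ j ∈ Finset.Icc 1 g, j) -
      C c * ∏ j ∈ Finset.Icc 1 g, esymm (Fin g) ℂ j).IsHomogeneous
        (∑ j ∈ Finset.Icc 1 g, j) := fun c => by
    refine IsHomogeneous.sub ?_ ?_
    · simpa using (isHomogeneous_esymm g 1).pow (∑ j ∈ Finset.Icc 1 g, j)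
    · exact (IsHomogeneous.prod _ _ _ fun j _ => isHomogeneous_esymm g j).C_mul c
  have hdeg : ∑ j ∈ Finset.Icc 1 g, j + ∑ i ∈ Finset.range g, i = g ^ 2 := by
    have h3 := sum_Icc_one_mul_two g
    have h4 := Finset.sum_range_id_mul_two g
    have h5 : g * (g + 1) + g * (g - 1) = g ^ 2 * 2 := by
      obtain ⟨n, rfl⟩ := Nat.exists_eq_add_of_le' hg
      rw [Nat.add_sub_cancel]
      ring
    omega
  refine mem_Ig_of_mul_vandermondePoly_mem (hsymm _)
    (((hsymm _).mul_isAlternatingPoly (isAlternatingPoly_vandermondePoly g)).mem_Ig ?_ ?_)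
  · rw [← hdeg]
    exact (hhom _).mul (isHomogeneous_vandermondePoly g)
  · rw [sub_mul, mul_assoc, coeff_sub, coeff_C_mul, div_mul_cancel₀ _ h2, sub_self]
end

section
/- Let 1 ≤ p ≤ q. Then there exists a nonzero scalar λ ∈ ℂ such that e_q(y)·e₁(x)^{(p−1)q} − λ·e_q(y)^p belongs to the ideal J_{p,q}; in particular, e_q(y)·e₁(x)^{(p−1)q} ∉ J_{p,q}. That is, in the quotient ring, τ_q·σ₁^{(p−1)q} is a nonzero multiple of τ_q^p and in particular does not vanish. -/
open MvPolynomial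

/-- `e_r(x)`, the `r`-th elementary symmetric polynomial in the `x`-variables
`x₁,…,x_p` of `ℂ[x₁,…,x_p, y₁,…,y_q]` (zero for `r > p`, and `e₀ = 1`). -/
noncomputable def ex (p q r : ℕ) : MvPolynomial (Fin p ⊕ Fin q) ℂ :=
  rename Sum.inl (esymm (Fin p) ℂ r)

/-- `e_s(y)`, the `s`-th elementary symmetric polynomial in the `y`-variables
`y₁,…,y_q` of `ℂ[x₁,…,x_p, y₁,…,y_q]` (zero for `s > q`, and `e₀ = 1`). -/
noncomputable def ey (p q s : ℕ) : MvPolynomial (Fin p ⊕ Fin q) ℂ :=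
  rename Sum.inr (esymm (Fin q) ℂ s)

/-- `c_k = Σ_{r+s=k} e_r(x) e_s(y)`, the degree-`k` homogeneous component of
`∏ᵢ(1+xᵢ) · ∏ⱼ(1+yⱼ) - 1`. -/
noncomputable def ck (p q k : ℕ) : MvPolynomial (Fin p ⊕ Fin q) ℂ :=
  ∑ r ∈ Finset.range (k + 1), ex p q r * ey p q (k - r)

/-- The ideal `J_{p,q}` generated by the `c_k` for `1 ≤ k ≤ p + q`. -/
noncomputable def Jpq (p q : ℕ) : Ideal (MvPolynomial (Fin p ⊕ Fin q) ℂ) :=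
  Ideal.span {f | ∃ k : ℕ, 1 ≤ k ∧ k ≤ p + q ∧ f = ck p q k}

section JacobiTrudi

variable {A : Type*} [CommRing A]

/-- The Jacobi–Trudi type matrix `(b (βᵢ - j))` attached to a sequence `b` and exponents `β`. -/
def jacobiTrudi {p : ℕ} (b : ℤ → A) (β : Fin p → ℕ) : Matrix (Fin p) (Fin p) A :=
  Matrix.of fun i j => b ((β i : ℤ) - j)

/-- For any square matrices `M` and `T`, replacing the rows of `M` one at a time by those of
`M * T` and summing the determinants multiplies `det M` by the trace of `T`. -/
lemma sum_det_updateRow_mul {n : Type*} [Fintype n] [DecidableEq n] (M T : Matrix n n A) :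
    ∑ i, (M.updateRow i ((M * T) i)).det = M.det * T.trace := by
  have h : ∀ i, (M.updateRow i ((M * T) i)).det = ((M * T) * M.adjugate) i i := by
    intro i
    rw [← Matrix.cramer_transpose_apply, Matrix.cramer_eq_adjugate_mulVec,
      ← Matrix.adjugate_transpose, Matrix.mul_apply]
    simp only [Matrix.mulVec, dotProduct, Matrix.transpose_apply]
    exact Finset.sum_congr rfl fun j _ => mul_comm _ _
  simp_rw [h]
  change ((M * T) * M.adjugate).trace = _
  rw [Matrix.trace_mul_comm, ← Matrix.mul_assoc, Matrix.adjugate_mul]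
  simp

/-- Pieri's rule for multiplication by `a 1`. -/
lemma pieri {p : ℕ} (a : ℕ → A) (b : ℤ → A) (ha : a 0 = 1)
    (hab : ∀ m : ℕ, 1 ≤ m → ∑ r ∈ Finset.range (p + 2), a r * b ((m : ℤ) - r) = 0)
    (β : Fin (p + 1) → ℕ) :
    ∑ i, (jacobiTrudi b (Function.update β i (β i + 1))).det
      = -a 1 * (jacobiTrudi b β).det := by
  let T : Matrix (Fin (p + 1)) (Fin (p + 1)) A :=
    Matrix.of fun k j => Fin.cases (-a (k + 1)) (fun j' => if k = j'.castSucc then 1 else 0) j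
  have hT : T.trace = -a 1 := by
    rw [Matrix.trace, Fin.sum_univ_succ]
    simp [T, Fin.ext_iff]
  have hrow : ∀ i, jacobiTrudi b (Function.update β i (β i + 1))
      = (jacobiTrudi b β).updateRow i ((jacobiTrudi b β * T) i) := by
    intro i
    ext k j
    by_cases hk : k = i
    · subst hk
      rw [Matrix.updateRow_self, Matrix.mul_apply]
      refine Fin.cases ?_ (fun j' => ?_) j
      · have h := hab (β k + 1) (by omega)
        rw [Finset.sum_range_succ', Finset.sum_range] at h
        simp only [jacobiTrudi, Matrix.of_apply, Function.update_self, T, Fin.cases_zero, Fin.val_zero]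
        simp only [ha] at h
        push_cast at h ⊢
        rw [one_mul] at h
        rw [eq_neg_of_add_eq_zero_right h, ← Finset.sum_neg_distrib]
        refine Finset.sum_congr rfl fun x _ => ?_
        rw [show (β k : ℤ) + 1 - ((x : ℤ) + 1) = β k - x by ring]
        ring
      · simp [jacobiTrudi, T]
    · rw [Matrix.updateRow_ne hk]
      simp [jacobiTrudi, hk]
  simp_rw [hrow]
  rw [sum_det_updateRow_mul, hT, mul_comm]

variable {p q : ℕ}

lemma det_jacobiTrudi_eq_zero_of_not_injective (b : ℤ → A) {β : Fin p → ℕ}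
    (hβ : ¬ Function.Injective β) : (jacobiTrudi b β).det = 0 := by
  simp only [Function.Injective, not_forall] at hβ
  obtain ⟨i, j, hij, hne⟩ := hβ
  exact Matrix.det_zero_of_row_eq hne (by ext k; simp [jacobiTrudi, hij])

lemma det_jacobiTrudi_eq_zero_of_le (b : ℤ → A) (hb : ∀ m : ℤ, q < m → b m = 0)
    {β : Fin p → ℕ} {i : Fin p} (hi : p + q ≤ β i) : (jacobiTrudi b β).det = 0 := by
  refine Matrix.det_eq_zero_of_row_eq_zero i fun j => hb _ ?_
  have := j.isLt
  omega

lemma det_jacobiTrudi_top (b : ℤ → A) (hb : ∀ m : ℤ, q < m → b m = 0) :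
    (jacobiTrudi b fun i : Fin p => q + (i : ℕ)).det = b q ^ p := by
  rw [Matrix.det_of_isUpperTriangular]
  · simp [jacobiTrudi]
  · intro i j hij
    refine hb _ ?_
    have : (j : ℕ) < i := hij
    push_cast
    omega

lemma det_jacobiTrudi_bot (b : ℤ → A) (hb : ∀ m : ℤ, m < 0 → b m = 0) (hb0 : b 0 = 1) :
    (jacobiTrudi b fun i : Fin p => (i : ℕ)).det = 1 := by
  rw [Matrix.det_of_isLowerTriangular]
  · simp [jacobiTrudi, hb0]
  · intro i j hij
    refine hb _ ?_
    have : (i : ℕ) < j := hij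
    simp only
    omega

lemma le_of_strictMono_of_lt {β : Fin p → ℕ} (hβ : StrictMono β) (hlt : ∀ i, β i < p + q)
    (i : Fin p) : β i ≤ q + i := by
  obtain ⟨d, hd⟩ : ∃ d, p = i + 1 + d := ⟨p - (i + 1), by omega⟩
  induction d generalizing i with
  | zero => have := hlt i; omega
  | succ d ih =>
    have h1 : (i : ℕ) + 1 < p := by omega
    have h2 := ih ⟨i + 1, h1⟩ (by simp only; omega)
    have h3 : β i < β ⟨i + 1, h1⟩ := hβ (Fin.lt_def.2 (by simp))
    simp only at h2
    omega

lemma strictMono_update_of_injective {β : Fin p → ℕ} (hβ : StrictMono β) {i : Fin p}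
    (hinj : Function.Injective (Function.update β i (β i + 1))) :
    StrictMono (Function.update β i (β i + 1)) := by
  intro j k hjk
  refine lt_of_le_of_ne ?_ (hinj.ne hjk.ne)
  have := hβ hjk
  by_cases h1 : j = i <;> by_cases h2 : k = i <;> simp_all <;> omega

lemma exists_strictMono_update {β : Fin p → ℕ} (hβ : StrictMono β) (hlt : ∀ i, β i < p + q)
    (hne : ∃ i : Fin p, β i < q + i) :
    ∃ i : Fin p, StrictMono (Function.update β i (β i + 1)) ∧
      ∀ j, Function.update β i (β i + 1) j < p + q := by
  classical
  obtain ⟨i, hi, hmax⟩ := (Finset.univ.filter fun i : Fin p => β i < q + i).exists_max_image id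
    (by simpa [Finset.Nonempty] using hne)
  simp only [Finset.mem_filter, Finset.mem_univ, true_and, id] at hi hmax
  refine ⟨i, strictMono_update_of_injective hβ ?_, fun j => ?_⟩
  · have key : ∀ j, j ≠ i → β j ≠ β i + 1 := by
      intro j hj h
      have hij : i < j := hβ.lt_iff_lt.1 (by omega)
      have : ¬ β j < q + j := fun h' => absurd (hmax j h') (not_le.2 hij)
      have : (i : ℕ) < j := hij
      omega
    intro j k hjk
    by_cases h1 : j = i <;> by_cases h2 : k = i
    · rw [h1, h2]
    · subst h1
      simp only [Function.update_self, Function.update_of_ne h2] at hjk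
      exact absurd hjk.symm (key k h2)
    · subst h2
      simp only [Function.update_self, Function.update_of_ne h1] at hjk
      exact absurd hjk (key j h1)
    · simp only [Function.update_of_ne h1, Function.update_of_ne h2] at hjk
      exact hβ.injective hjk
  · by_cases h : j = i
    · subst h
      simp only [Function.update_self]
      omega
    · simpa [h] using hlt j

lemma sum_sub_update {β : Fin p → ℕ} {k : ℕ}
    (hk : ∑ i : Fin p, β i + (k + 1) = ∑ i : Fin p, (q + (i : ℕ))) (i : Fin p) :
    ∑ j : Fin p, Function.update β i (β i + 1) j + k = ∑ i : Fin p, (q + (i : ℕ)) := by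
  rw [← hk, Finset.sum_update_of_mem (Finset.mem_univ i),
    ← Finset.add_sum_erase _ β (Finset.mem_univ i), Finset.sdiff_singleton_eq_erase]
  omega

/-- Multiplying a Jacobi–Trudi determinant by a complementary power of `-a 1` yields a positive
multiple of `b q ^ p`. -/
lemma exists_pow_mul_det_jacobiTrudi (a : ℕ → A) (b : ℤ → A) (ha : a 0 = 1)
    (hb : ∀ m : ℤ, q < m → b m = 0)
    (hab : ∀ m : ℕ, 1 ≤ m → ∑ r ∈ Finset.range (p + 1), a r * b ((m : ℤ) - r) = 0)
    (k : ℕ) (β : Fin p → ℕ) (hβ : StrictMono β) (hlt : ∀ i, β i < p + q)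
    (hk : ∑ i : Fin p, β i + k = ∑ i : Fin p, (q + (i : ℕ))) :
    ∃ N : ℕ, 0 < N ∧ (-a 1) ^ k * (jacobiTrudi b β).det = N * b q ^ p := by
  induction k generalizing β with
  | zero =>
    have hle := le_of_strictMono_of_lt hβ hlt
    have h := (Finset.sum_eq_sum_iff_of_le fun i _ => hle i).1 (by simpa using hk)
    have : β = fun i : Fin p => q + (i : ℕ) := funext fun i => h i (Finset.mem_univ i)
    exact ⟨1, one_pos, by rw [this, det_jacobiTrudi_top b hb]; simp⟩
  | succ k ih =>
    cases p with
    | zero => simp at hk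
    | succ p =>
      have hne : ∃ i : Fin (p + 1), β i < q + i := by
        by_contra! hcon
        have := Finset.sum_le_sum fun i (_ : i ∈ Finset.univ) => hcon i
        omega
      obtain ⟨i₀, hi₀, hi₀'⟩ := exists_strictMono_update hβ hlt hne
      have hex : ∀ i, ∃ N : ℕ, (i = i₀ → 0 < N) ∧
          (-a 1) ^ k * (jacobiTrudi b (Function.update β i (β i + 1))).det
            = N * b q ^ (p + 1) := by
        intro i
        by_cases hgood : StrictMono (Function.update β i (β i + 1)) ∧
            ∀ j, Function.update β i (β i + 1) j < p + 1 + q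
        · obtain ⟨N, hN, h⟩ := ih _ hgood.1 hgood.2 (sum_sub_update hk i)
          exact ⟨N, fun _ => hN, h⟩
        · refine ⟨0, fun h => absurd ⟨h ▸ hi₀, h ▸ hi₀'⟩ hgood, ?_⟩
          have : (jacobiTrudi b (Function.update β i (β i + 1))).det = 0 := by
            by_cases hinj : Function.Injective (Function.update β i (β i + 1))
            · have : ¬ ∀ j, Function.update β i (β i + 1) j < p + 1 + q :=
                fun h => hgood ⟨strictMono_update_of_injective hβ hinj, h⟩
              push Not at this
              obtain ⟨j, hj⟩ := this
              exact det_jacobiTrudi_eq_zero_of_le b hb hj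
            · exact det_jacobiTrudi_eq_zero_of_not_injective b hinj
          simp [this]
      choose N hN hN' using hex
      refine ⟨∑ i, N i, ?_, ?_⟩
      · exact lt_of_lt_of_le (hN i₀ rfl)
          (Finset.single_le_sum (fun _ _ => Nat.zero_le _) (Finset.mem_univ i₀))
      · rw [pow_succ, mul_assoc, ← pieri a b ha hab, Finset.mul_sum,
          Finset.sum_congr rfl fun i _ => hN' i, Nat.cast_sum, Finset.sum_mul]

lemma exists_pow_eq_mul_pow (a : ℕ → A) (b : ℤ → A) (ha : a 0 = 1) (hb0 : b 0 = 1)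
    (hneg : ∀ m : ℤ, m < 0 → b m = 0) (hb : ∀ m : ℤ, q < m → b m = 0)
    (hab : ∀ m : ℕ, 1 ≤ m → ∑ r ∈ Finset.range (p + 1), a r * b ((m : ℤ) - r) = 0) :
    ∃ N : ℕ, 0 < N ∧ (-a 1) ^ (p * q) = N * b q ^ p := by
  obtain ⟨N, hN, h⟩ := exists_pow_mul_det_jacobiTrudi a b ha hb hab (p * q)
    (fun i : Fin p => (i : ℕ)) (fun _ _ h => h) (fun i => by omega)
    (by simp [Finset.sum_add_distrib, add_comm])
  exact ⟨N, hN, by rwa [det_jacobiTrudi_bot b hneg hb0, mul_one] at h⟩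

end JacobiTrudi

section Coinvariants

variable {σ R : Type*} [Fintype σ] [CommRing R]

lemma coeff_prod_one_add_C_mul_X (f : σ → R) (k : ℕ) :
    (∏ i, (1 + Polynomial.C (f i) * Polynomial.X)).coeff k
      = ∑ t ∈ Finset.powersetCard k Finset.univ, ∏ i ∈ t, f i := by
  classical
  rw [Finset.prod_one_add, Polynomial.finsetSum_coeff, Finset.powersetCard_eq_filter,
    Finset.sum_filter]
  refine Finset.sum_congr rfl fun t _ => ?_
  rw [Finset.prod_mul_distrib, Finset.prod_const, ← map_prod, Polynomial.coeff_C_mul_X_pow]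
  simp only [eq_comm]

/-- An injective exponent bounded by a bijective enumeration `σ → {0, …, n - 1}` equals it. -/
lemma eq_of_le_of_injective {d e : σ → ℕ} (hd : Function.Injective d)
    (hlt : ∀ s, d s < Fintype.card σ) (he : Function.Injective e) (hle : ∀ s, e s ≤ d s) :
    e = d := by
  have himg : ∀ g : σ → ℕ, Function.Injective g → (∀ s, g s < Fintype.card σ) →
      ∑ s, g s = ∑ i ∈ Finset.range (Fintype.card σ), i := by
    intro g hg hglt
    rw [← Finset.eq_of_subset_of_card_le (s := Finset.univ.image g)
      (t := Finset.range (Fintype.card σ)) (by simpa [Finset.subset_iff] using hglt)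
      (by rw [Finset.card_image_of_injective _ hg]; simp), Finset.sum_image hg.injOn]
  have hsum : ∑ s, e s = ∑ s, d s := by
    rw [himg d hd hlt, himg e he fun s => (hle s).trans_lt (hlt s)]
  exact funext fun s =>
    (Finset.sum_eq_sum_iff_of_le fun s _ => hle s).1 hsum s (Finset.mem_univ s)

variable [DecidableEq σ]

/-- Antisymmetrization of a polynomial over all permutations of the variables. -/
noncomputable def antisymmetrize : MvPolynomial σ R →ₗ[R] MvPolynomial σ R :=
  ∑ w : Equiv.Perm σ, ((Equiv.Perm.sign w : ℤ) : R) • (rename w).toLinearMap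

lemma antisymmetrize_apply (f : MvPolynomial σ R) :
    antisymmetrize f = ∑ w : Equiv.Perm σ, ((Equiv.Perm.sign w : ℤ) : R) • rename w f := by
  simp [antisymmetrize]

lemma antisymmetrize_mul_of_isSymmetric (f : MvPolynomial σ R) {c : MvPolynomial σ R}
    (hc : c.IsSymmetric) : antisymmetrize (f * c) = antisymmetrize f * c := by
  simp only [antisymmetrize_apply, Finset.sum_mul, map_mul, hc _, smul_mul_assoc]

lemma rename_swap_antisymmetrize {i j : σ} (hij : i ≠ j) (f : MvPolynomial σ R) :
    rename (Equiv.swap i j) (antisymmetrize f) = -antisymmetrize f := by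
  simp only [antisymmetrize_apply, map_sum, map_smul, rename_rename, ← Finset.sum_neg_distrib]
  refine Fintype.sum_equiv (Equiv.mulLeft (Equiv.swap i j)) _ _ fun w => ?_
  simp [Equiv.Perm.sign_swap hij, Equiv.Perm.coe_mul]

lemma coeff_antisymmetrize_eq_zero [NoZeroDivisors R] [CharZero R] (f : MvPolynomial σ R)
    {d : σ →₀ ℕ} (hd : ¬ Function.Injective d) : coeff d (antisymmetrize f) = 0 := by
  simp only [Function.Injective, not_forall] at hd
  obtain ⟨i, j, hdij, hij⟩ := hd
  have h1 := coeff_rename_mapDomain (Equiv.swap i j) (Equiv.injective _) (antisymmetrize f) d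
  have h2 : d.mapDomain (Equiv.swap i j) = d := by
    rw [← Finsupp.equivMapDomain_eq_mapDomain]
    ext s
    rw [Finsupp.equivMapDomain_apply, Equiv.symm_swap, Equiv.swap_apply_def]
    split_ifs with h h' <;> simp_all
  rw [h2, rename_swap_antisymmetrize hij, coeff_neg] at h1
  exact self_eq_neg.1 h1.symm

lemma coeff_antisymmetrize_mul_eq_zero [NoZeroDivisors R] [CharZero R] {d : σ →₀ ℕ}
    (hd : Function.Injective d) (hlt : ∀ s, d s < Fintype.card σ) (f : MvPolynomial σ R)
    {c : MvPolynomial σ R} (hc : c.IsSymmetric) (hc0 : coeff 0 c = 0) :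
    coeff d (antisymmetrize (f * c)) = 0 := by
  rw [antisymmetrize_mul_of_isSymmetric f hc, coeff_mul]
  refine Finset.sum_eq_zero fun x hx => ?_
  rw [Finset.HasAntidiagonal.mem_antidiagonal] at hx
  by_cases hinj : Function.Injective x.1
  · have h1 : (x.1 : σ → ℕ) = d :=
      eq_of_le_of_injective hd hlt hinj fun s => by simp [← hx]
    have h2 : x.2 = 0 := by
      rw [DFunLike.coe_fn_eq.1 h1] at hx
      simpa using hx
    rw [h2, hc0, mul_zero]
  · rw [coeff_antisymmetrize_eq_zero f hinj, zero_mul]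

lemma coeff_antisymmetrize_monomial {d : σ →₀ ℕ} (hd : Function.Injective d) :
    coeff d (antisymmetrize (monomial d (1 : R))) = 1 := by
  rw [antisymmetrize_apply, coeff_sum, Finset.sum_eq_single 1]
  · simp
  · intro w _ hw
    rw [rename_monomial, coeff_smul, coeff_monomial, if_neg, smul_zero]
    intro h
    refine hw (Equiv.ext fun s => hd ?_)
    have := Finsupp.mapDomain_apply w.injective d s
    rwa [h] at this
  · simp

lemma monomial_notMem_span [NoZeroDivisors R] [CharZero R] {d : σ →₀ ℕ}
    (hd : Function.Injective d) (hlt : ∀ s, d s < Fintype.card σ) (S : Set (MvPolynomial σ R))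
    (hS : ∀ c ∈ S, c.IsSymmetric ∧ coeff 0 c = 0) :
    monomial d (1 : R) ∉ Ideal.span S := by
  intro hmem
  have key : ∀ f ∈ Ideal.span S, ∀ g, coeff d (antisymmetrize (g * f)) = 0 := by
    intro f hf
    induction hf using Submodule.span_induction with
    | mem c hc =>
      exact fun g => coeff_antisymmetrize_mul_eq_zero hd hlt g (hS c hc).1 (hS c hc).2
    | zero => simp
    | add x y _ _ hx hy => intro g; rw [mul_add, map_add, coeff_add, hx, hy, add_zero]
    | smul r x _ hx => intro g; rw [smul_eq_mul, ← mul_assoc]; exact hx _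
  have h := key _ hmem 1
  rw [one_mul, coeff_antisymmetrize_monomial hd] at h
  exact one_ne_zero h

end Coinvariants

lemma esymm_eq_zero_of_card_lt {σ R : Type*} [Fintype σ] [CommSemiring R] {k : ℕ}
    (h : Fintype.card σ < k) : esymm σ R k = 0 := by
  rw [esymm, Finset.powersetCard_eq_empty.2 (by simpa using h), Finset.sum_empty]

lemma coeff_zero_esymm {σ R : Type*} [Fintype σ] [CommSemiring R] {k : ℕ} (hk : 1 ≤ k) :
    coeff 0 (esymm σ R k) = 0 := by
  rw [← constantCoeff_eq, esymm, map_sum]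
  refine Finset.sum_eq_zero fun t ht => ?_
  rw [Finset.mem_powersetCard] at ht
  rw [map_prod]
  simp only [constantCoeff_X, Finset.prod_const, ht.2]
  exact zero_pow (by omega)

lemma ck_eq_esymm (p q k : ℕ) : ck p q k = esymm (Fin p ⊕ Fin q) ℂ k := by
  rw [esymm, ← coeff_prod_one_add_C_mul_X, Fintype.prod_sum_type, Polynomial.coeff_mul,
    Finset.Nat.sum_antidiagonal_eq_sum_range_succ_mk, ck]
  refine Finset.sum_congr rfl fun r _ => ?_
  simp [coeff_prod_one_add_C_mul_X, ex, ey, esymm]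

lemma ex_eq_zero {p q r : ℕ} (h : p < r) : ex p q r = 0 := by
  rw [ex, esymm_eq_zero_of_card_lt (by simpa using h), map_zero]

lemma ey_eq_zero {p q s : ℕ} (h : q < s) : ey p q s = 0 := by
  rw [ey, esymm_eq_zero_of_card_lt (by simpa using h), map_zero]

lemma ck_mem_Jpq {p q k : ℕ} (hk : 1 ≤ k) : ck p q k ∈ Jpq p q := by
  by_cases h : k ≤ p + q
  · exact Ideal.subset_span ⟨k, hk, h, rfl⟩
  · rw [ck_eq_esymm, esymm_eq_zero_of_card_lt (by simpa using h)]
    exact zero_mem _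

/-- `e_m(y)` indexed by integers, zero for negative `m`. -/
noncomputable def eyInt (p q : ℕ) (m : ℤ) : MvPolynomial (Fin p ⊕ Fin q) ℂ :=
  if 0 ≤ m then ey p q m.toNat else 0

lemma ck_eq_sum_eyInt (p q m : ℕ) :
    ck p q m = ∑ r ∈ Finset.range (p + 1), ex p q r * eyInt p q ((m : ℤ) - r) := by
  have h1 : ck p q m = ∑ r ∈ Finset.range (m + 1), ex p q r * eyInt p q ((m : ℤ) - r) := by
    refine Finset.sum_congr rfl fun r hr => ?_
    rw [Finset.mem_range] at hr
    rw [eyInt, if_pos (by omega), show ((m : ℤ) - r).toNat = m - r by omega]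
  rw [h1]
  rcases le_total p m with h | h
  · refine (Finset.sum_subset (Finset.range_subset_range.2 (by omega)) fun r _ hr => ?_).symm
    rw [Finset.mem_range] at hr
    rw [ex_eq_zero (by omega), zero_mul]
  · refine Finset.sum_subset (Finset.range_subset_range.2 (by omega)) fun r _ hr => ?_
    rw [Finset.mem_range] at hr
    rw [eyInt, if_neg (by omega), mul_zero]

lemma ex_mul_ey_mem_Jpq {p q : ℕ} (hp : 1 ≤ p) : ex p q p * ey p q q ∈ Jpq p q := by
  have h : ck p q (p + q) = ex p q p * ey p q q := by
    rw [ck, Finset.sum_eq_single p]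
    · simp
    · intro r hr hne
      rw [Finset.mem_range] at hr
      rcases lt_or_gt_of_ne hne with h | h
      · rw [ey_eq_zero (by omega), mul_zero]
      · rw [ex_eq_zero h, zero_mul]
    · simp
  exact h ▸ ck_mem_Jpq (by omega)

lemma sum_ex_mul_eyInt_mul_ey_mem_Jpq (p q : ℕ) {m : ℕ} (hm : 1 ≤ m) :
    (∑ r ∈ Finset.range (p + 1), ex (p + 1) q r * eyInt (p + 1) q ((m : ℤ) - r)) *
      ey (p + 1) q q ∈ Jpq (p + 1) q := by
  have h := ck_eq_sum_eyInt (p + 1) q m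
  rw [Finset.sum_range_succ] at h
  rw [eq_sub_of_add_eq h.symm, sub_mul, mul_right_comm]
  exact sub_mem (Ideal.mul_mem_right _ _ (ck_mem_Jpq hm))
    (Ideal.mul_mem_right _ _ (ex_mul_ey_mem_Jpq (by omega)))

lemma ey_pow_notMem_Jpq (p q : ℕ) : ey p q q ^ p ∉ Jpq p q := by
  intro hmem
  let d : Fin p ⊕ Fin q →₀ ℕ :=
    Finsupp.equivFunOnFinite.symm (Sum.elim (fun i => (i : ℕ)) fun j => p + (j : ℕ))
  have hd : Function.Injective d := by
    rintro (i | i) (j | j) h <;>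
      simp only [d, Finsupp.equivFunOnFinite_symm_apply_apply, Sum.elim_inl, Sum.elim_inr] at h
    · exact congrArg _ (Fin.ext h)
    · omega
    · omega
    · exact congrArg _ (Fin.ext (by omega))
  have hlt : ∀ s, d s < Fintype.card (Fin p ⊕ Fin q) := by
    rintro (i | i)
    · simp [d]; omega
    · simp [d]
  have hey : ey p q q = ∏ j : Fin q, X (Sum.inr j) := by
    have : Finset.powersetCard q (Finset.univ : Finset (Fin q)) = {Finset.univ} := by
      simpa using Finset.powersetCard_self (Finset.univ : Finset (Fin q))
    rw [ey, esymm, this, Finset.sum_singleton, map_prod]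
    simp
  refine monomial_notMem_span (R := ℂ) hd hlt
    {f | ∃ k : ℕ, 1 ≤ k ∧ k ≤ p + q ∧ f = ck p q k} ?_ ?_
  · rintro _ ⟨k, hk, -, rfl⟩
    rw [ck_eq_esymm]
    exact ⟨esymm_isSymmetric _ _ _, coeff_zero_esymm hk⟩
  · have hmon : monomial d (1 : ℂ) = ((∏ i : Fin p, X (Sum.inl i) ^ (i : ℕ)) *
        ∏ j : Fin q, X (Sum.inr j) ^ (j : ℕ)) * ey p q q ^ p := by
      rw [monomial_eq, Finsupp.prod_fintype _ _ (by simp), Fintype.prod_sum_type, hey,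
        mul_assoc, ← Finset.prod_pow, ← Finset.prod_mul_distrib]
      simp [d, pow_add, mul_comm]
    rw [hmon]
    exact Ideal.mul_mem_left _ _ hmem

/-- (Remark `unitr`) For `1 ≤ p ≤ q`, there is a nonzero scalar `λ` with
`e_q(y) · e₁(x)^{(p-1)q} - λ · e_q(y)^p ∈ J_{p,q}`; in particular
`e_q(y) · e₁(x)^{(p-1)q} ∉ J_{p,q}`: in the quotient, `τ_q σ₁^{(p-1)q}` is a
nonzero multiple of `τ_q^p` and in particular does not vanish. -/
theorem stmt_8 (p q : ℕ) (hp : 1 ≤ p) (hpq : p ≤ q) :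
    (∃ lam : ℂ, lam ≠ 0 ∧
      ey p q q * (ex p q 1) ^ ((p - 1) * q) - C lam * (ey p q q) ^ p ∈ Jpq p q) ∧
      ey p q q * (ex p q 1) ^ ((p - 1) * q) ∉ Jpq p q := by
  have main : ∃ lam : ℂ, lam ≠ 0 ∧
      ey p q q * (ex p q 1) ^ ((p - 1) * q) - C lam * (ey p q q) ^ p ∈ Jpq p q := by
    obtain ⟨p, rfl⟩ : ∃ p', p = p' + 1 := ⟨p - 1, by omega⟩
    let K : Ideal (MvPolynomial (Fin (p + 1) ⊕ Fin q) ℂ) :=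
      (Jpq (p + 1) q).colon {ey (p + 1) q q}
    have hK : ∀ f, f ∈ K ↔ f * ey (p + 1) q q ∈ Jpq (p + 1) q := fun f =>
      Submodule.mem_colon_singleton
    obtain ⟨N, hN, h⟩ := exists_pow_eq_mul_pow (p := p) (q := q)
      (fun r => Ideal.Quotient.mk K (ex (p + 1) q r))
      (fun m => Ideal.Quotient.mk K (eyInt (p + 1) q m))
      (by simp [ex]) (by simp [eyInt, ey])
      (fun m hm => by simp [eyInt, not_le.2 hm])
      (fun m hm => by rw [eyInt, if_pos (by omega), ey_eq_zero (by omega), map_zero])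
      (fun m hm => by
        simp only [← map_mul, ← map_sum]
        exact Ideal.Quotient.eq_zero_iff_mem.2
          ((hK _).2 (sum_ex_mul_eyInt_mul_ey_mem_Jpq p q hm)))
    have hq : eyInt (p + 1) q q = ey (p + 1) q q := by simp [eyInt]
    simp only [hq] at h
    rw [← map_neg, ← map_pow, ← map_pow, ← map_natCast (Ideal.Quotient.mk K), ← map_mul,
      Ideal.Quotient.eq, hK] at h
    refine ⟨(-1) ^ (p * q) * N, by simp; omega, ?_⟩
    have hsq : ((-1) ^ (p * q) * (-1) ^ (p * q) : MvPolynomial (Fin (p + 1) ⊕ Fin q) ℂ) = 1 := by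
      rw [← mul_pow]; simp
    convert Ideal.mul_mem_left _ ((-1) ^ (p * q)) h using 1
    rw [neg_pow (ex (p + 1) q 1)]
    simp only [map_mul, map_pow, map_neg, map_one, map_natCast, Nat.add_sub_cancel]
    linear_combination -(ey (p + 1) q q * ex (p + 1) q 1 ^ (p * q)) * hsq
  refine ⟨main, fun hmem => ?_⟩
  obtain ⟨lam, hlam, h⟩ := main
  have h1 : C lam * ey p q q ^ p ∈ Jpq p q := by simpa using sub_mem hmem h
  have h2 := Ideal.mul_mem_left _ (C lam⁻¹) h1
  rw [← mul_assoc, ← C_mul, inv_mul_cancel₀ hlam, C_1, one_mul] at h2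
  exact ey_pow_notMem_Jpq p q h2
end
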